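/- If t₀ ∈ (0,1) satisfies Y(t₀) = 1, then 0.00073969896 < B₀(t₀) < 0.00073970019. -/

import Mathlib

noncomputable def h1 (t : ℝ) : ℝ := (2*t+1)/((3*t+1)*(1-t))

noncomputable def h2 (t : ℝ) : ℝ :=
  -(t^2*(1-t)*(5*t^2+36*t+18))/(2*(t+3)*(2*t+1)*(3*t+1)^2)

noncomputable def Y (t : ℝ) : ℝ := -1 + h1 t * Real.exp (h2 t)

noncomputable def B0 (t : ℝ) : ℝ :=
  (3*t-1)^2*(t+1)^6*Real.log (t+1)/(512*t^6)
  - (3*t^4-16*t^3+6*t^2-1)*Real.log (3*t+1)/(32*t^3)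
  - (3*t+1)^2*(1-t)^6*Real.log (2*t+1)/(1024*t^6)
  + (1/4)*Real.log (t+3) - (1/2)*Real.log t - (3/8)*Real.log 16
  - (217*t^6+920*t^5+972*t^4+1436*t^3+205*t^2-172*t+6)*(1-t)^2/(2048*t^4*(3*t+1)*(t+3))


lemma log_ge_aux (q x r : ℝ) (n : ℕ) (h0 : 0 ≤ x) (h1 : x < 1) (hq : q = (1+x)/(1-x))
    (h : r ≤ 2 * ∑ i ∈ Finset.range n, x ^ (2 * i + 1) / (2 * i + 1)) : r ≤ Real.log q := by
  have := Real.sum_range_le_log_div h0 h1 n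
  rw [hq]; linarith

lemma log_le_aux (q x r : ℝ) (n : ℕ) (h0 : 0 ≤ x) (h1 : x < 1) (hq : q = (1+x)/(1-x))
    (h : 2 * ((∑ i ∈ Finset.range n, x ^ (2 * i + 1) / (2 * i + 1)) + x ^ (2 * n + 1) / (1 - x ^ 2)) ≤ r) :
    Real.log q ≤ r := by
  have := Real.log_div_le_sum_range_add h0 h1 n
  rw [hq]; linarith

lemma log_neg_aux (q x : ℝ) (hq : q = (1-x)/(1+x)) : Real.log q = - Real.log ((1+x)/(1-x)) := by
  rw [hq, ← Real.log_inv, inv_div]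

lemma lg2_l : (0.6931471805595:ℝ) ≤ Real.log (2) := by
  refine log_ge_aux _ ((2-1)/(2+1)) _ 14 (by norm_num) (by norm_num) (by norm_num) ?_
  norm_num [Finset.sum_range_succ]

lemma lg2_u : Real.log (2) ≤ (0.6931471805604:ℝ) := by
  refine log_le_aux _ ((2-1)/(2+1)) _ 14 (by norm_num) (by norm_num) (by norm_num) ?_
  norm_num [Finset.sum_range_succ]

lemma lp1a_l : (0.4863515602217:ℝ) ≤ Real.log (1.626371663301) := by
  refine log_ge_aux _ ((1.626371663301-1)/(1.626371663301+1)) _ 12 (by norm_num) (by norm_num) (by norm_num) ?_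
  norm_num [Finset.sum_range_succ]

lemma lp2a_l : (0.8121487297941:ℝ) ≤ Real.log (2.252743326602) := by
  refine log_ge_aux _ ((2.252743326602-1)/(2.252743326602+1)) _ 16 (by norm_num) (by norm_num) (by norm_num) ?_
  norm_num [Finset.sum_range_succ]

lemma lp2a_u : Real.log (2.252743326602) ≤ (0.8121487297950:ℝ) := by
  refine log_le_aux _ ((2.252743326602-1)/(2.252743326602+1)) _ 16 (by norm_num) (by norm_num) (by norm_num) ?_
  norm_num [Finset.sum_range_succ]

lemma lp3a_l : (1.0574829517500:ℝ) ≤ Real.log (2.879114989903) := by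
  refine log_ge_aux _ ((2.879114989903-1)/(2.879114989903+1)) _ 21 (by norm_num) (by norm_num) (by norm_num) ?_
  norm_num [Finset.sum_range_succ]

lemma lp3a_u : Real.log (2.879114989903) ≤ (1.0574829517509:ℝ) := by
  refine log_le_aux _ ((2.879114989903-1)/(2.879114989903+1)) _ 21 (by norm_num) (by norm_num) (by norm_num) ?_
  norm_num [Finset.sum_range_succ]

lemma lq3a_l : (1.2882326066109:ℝ) ≤ Real.log (3.626371663301) := by
  refine log_ge_aux _ ((3.626371663301-1)/(3.626371663301+1)) _ 27 (by norm_num) (by norm_num) (by norm_num) ?_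
  norm_num [Finset.sum_range_succ]

lemma lta_l : (-0.4678113727159:ℝ) ≤ Real.log (0.626371663301) := by
  have h : Real.log ((1+((1-0.626371663301)/(1+0.626371663301)))/(1-((1-0.626371663301)/(1+0.626371663301)))) ≤ 0.4678113727159 := by
    refine log_le_aux _ ((1-0.626371663301)/(1+0.626371663301)) _ 12 (by norm_num) (by norm_num) rfl ?_
    norm_num [Finset.sum_range_succ]
  rw [log_neg_aux (0.626371663301) ((1-0.626371663301)/(1+0.626371663301)) (by norm_num)]
  linarith

lemma lma_l : (-0.9844937278088:ℝ) ≤ Real.log (0.373628336699) := by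
  have h : Real.log ((1+((1-0.373628336699)/(1+0.373628336699)))/(1-((1-0.373628336699)/(1+0.373628336699)))) ≤ 0.9844937278088 := by
    refine log_le_aux _ ((1-0.373628336699)/(1+0.373628336699)) _ 20 (by norm_num) (by norm_num) rfl ?_
    norm_num [Finset.sum_range_succ]
  rw [log_neg_aux (0.373628336699) ((1-0.373628336699)/(1+0.373628336699)) (by norm_num)]
  linarith

lemma lp1b_u : Real.log (1.626371663312) ≤ (0.4863515602294:ℝ) := by
  refine log_le_aux _ ((1.626371663312-1)/(1.626371663312+1)) _ 12 (by norm_num) (by norm_num) (by norm_num) ?_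
  norm_num [Finset.sum_range_succ]

lemma lp2b_l : (0.8121487298039:ℝ) ≤ Real.log (2.252743326624) := by
  refine log_ge_aux _ ((2.252743326624-1)/(2.252743326624+1)) _ 16 (by norm_num) (by norm_num) (by norm_num) ?_
  norm_num [Finset.sum_range_succ]

lemma lp2b_u : Real.log (2.252743326624) ≤ (0.8121487298048:ℝ) := by
  refine log_le_aux _ ((2.252743326624-1)/(2.252743326624+1)) _ 16 (by norm_num) (by norm_num) (by norm_num) ?_
  norm_num [Finset.sum_range_succ]

lemma lp3b_l : (1.0574829517615:ℝ) ≤ Real.log (2.879114989936) := by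
  refine log_ge_aux _ ((2.879114989936-1)/(2.879114989936+1)) _ 21 (by norm_num) (by norm_num) (by norm_num) ?_
  norm_num [Finset.sum_range_succ]

lemma lp3b_u : Real.log (2.879114989936) ≤ (1.0574829517624:ℝ) := by
  refine log_le_aux _ ((2.879114989936-1)/(2.879114989936+1)) _ 21 (by norm_num) (by norm_num) (by norm_num) ?_
  norm_num [Finset.sum_range_succ]

lemma lq3b_u : Real.log (3.626371663312) ≤ (1.2882326066149:ℝ) := by
  refine log_le_aux _ ((3.626371663312-1)/(3.626371663312+1)) _ 27 (by norm_num) (by norm_num) (by norm_num) ?_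
  norm_num [Finset.sum_range_succ]

lemma ltb_u : Real.log (0.626371663312) ≤ (-0.4678113726974:ℝ) := by
  have h : 0.4678113726974 ≤ Real.log ((1+((1-0.626371663312)/(1+0.626371663312)))/(1-((1-0.626371663312)/(1+0.626371663312)))) := by
    refine log_ge_aux _ ((1-0.626371663312)/(1+0.626371663312)) _ 12 (by norm_num) (by norm_num) rfl ?_
    norm_num [Finset.sum_range_succ]
  rw [log_neg_aux (0.626371663312) ((1-0.626371663312)/(1+0.626371663312)) (by norm_num)]
  linarith

lemma lmb_u : Real.log (0.373628336688) ≤ (-0.9844937278373:ℝ) := by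
  have h : 0.9844937278373 ≤ Real.log ((1+((1-0.373628336688)/(1+0.373628336688)))/(1-((1-0.373628336688)/(1+0.373628336688)))) := by
    refine log_ge_aux _ ((1-0.373628336688)/(1+0.373628336688)) _ 20 (by norm_num) (by norm_num) rfl ?_
    norm_num [Finset.sum_range_succ]
  rw [log_neg_aux (0.373628336688) ((1-0.373628336688)/(1+0.373628336688)) (by norm_num)]
  linarith


noncomputable def FF (t : ℝ) : ℝ := Real.log (2*t+1) - Real.log (3*t+1) - Real.log (1-t) + h2 t

lemma FF_mono : StrictMonoOn FF (Set.Ioo 0 1) := by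
  have key : ∀ t ∈ Set.Ioo (0:ℝ) 1, ∃ d, 0 < d ∧ HasDerivAt FF d t := by
    rintro t ⟨h0, h1⟩
    have hid := hasDerivAt_id' t
    have e1 : 2*t+1 ≠ 0 := by positivity
    have e2 : 3*t+1 ≠ 0 := by positivity
    have e3 : 1-t ≠ 0 := by linarith
    have e3' : 0 < 1-t := by linarith
    have e4 : 2*(t+3)*(2*t+1)*(3*t+1)^2 ≠ 0 := by positivity
    have d1 := ((hid.const_mul 2).add_const 1).log e1
    have d2 := ((hid.const_mul 3).add_const 1).log e2
    have d3 := (hid.const_sub 1).log e3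
    have dN := ((((hid.pow 2).mul (hid.const_sub 1)).mul
      ((((hid.pow 2).const_mul 5).add (hid.const_mul 36)).add_const 18))).neg
    have dD := (((hid.add_const 3).const_mul 2).mul ((hid.const_mul 2).add_const 1)).mul
      (((hid.const_mul 3).add_const 1).pow 2)
    have d4 := dN.div dD e4
    have d := ((d1.sub d2).sub d3).add d4
    refine ⟨_, ?_, d⟩
    have : 0 < (t^2*(1728 + 14016*t + 41568*t^2 + 54804*t^3 + 30456*t^4 + 5088*t^5 - 24*t^6 - 180*t^7))
        / ((2*(t+3)*(2*t+1)*(3*t+1)^2)^2*(1-t)) := by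
      apply div_pos
      · apply mul_pos (by positivity)
        have : t^6 ≤ 1 := pow_le_one₀ h0.le h1.le
        have : t^7 ≤ 1 := pow_le_one₀ h0.le h1.le
        have : 0 < 14016*t + 41568*t^2 + 54804*t^3 + 30456*t^4 + 5088*t^5 := by positivity
        linarith
      · positivity
    convert this using 1
    simp
    field_simp
    ring
  refine strictMonoOn_of_deriv_pos (convex_Ioo 0 1) ?_ ?_
  · intro t ht
    obtain ⟨d, _, hd⟩ := key t ht
    exact hd.continuousAt.continuousWithinAt
  · rw [interior_Ioo]
    intro t ht
    obtain ⟨d, hp, hd⟩ := key t ht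
    rwa [hd.deriv]

lemma FF_of_Y (t : ℝ) (ht : t ∈ Set.Ioo (0:ℝ) 1) (h : Y t = 1) : FF t = Real.log 2 := by
  obtain ⟨h0, hl⟩ := ht
  have e3 : 0 < 1-t := by linarith
  have h' : h1 t * Real.exp (h2 t) = 2 := by unfold Y at h; linarith
  have hp : 0 < h1 t := by unfold h1; positivity
  rw [← h', Real.log_mul hp.ne' (Real.exp_pos _).ne', Real.log_exp, h1,
    Real.log_div (by positivity) (by positivity), Real.log_mul (by positivity) (by positivity), FF]
  ring


lemma FF_a : FF 0.626371663301 < Real.log 2 := by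
  have k1 := lp2a_u
  have k2 := lp3a_l
  have k3 := lma_l
  have k4 := lg2_l
  unfold FF h2
  norm_num at *
  linarith

lemma FF_b : Real.log 2 < FF 0.626371663312 := by
  have k1 := lp2b_l
  have k2 := lp3b_u
  have k3 := lmb_u
  have k4 := lg2_u
  unfold FF h2
  norm_num at *
  linarith

lemma t_bounds (t : ℝ) (ht : t ∈ Set.Ioo (0:ℝ) 1) (h : Y t = 1) : 0.626371663301 < t ∧ t < 0.626371663312 := by
  have hF := FF_of_Y t ht h
  constructor
  · rw [← FF_mono.lt_iff_lt (by norm_num) ht, hF]; exact FF_a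
  · rw [← FF_mono.lt_iff_lt ht (by norm_num), hF]; exact FF_b


theorem B0_at_t0 : ∀ t₀ : ℝ, t₀ ∈ Set.Ioo (0:ℝ) 1 → Y t₀ = 1 →
    0.00073969896 < B0 t₀ ∧ B0 t₀ < 0.00073970019 := by
  intro t ht hY
  obtain ⟨ha, hb⟩ := t_bounds t ht hY
  obtain ⟨h0, h1⟩ := ht
  have L1l : (0.4863515602217:ℝ) ≤ Real.log (t+1) := lp1a_l.trans (Real.log_le_log (by norm_num) (by linarith))
  have L1u : Real.log (t+1) ≤ (0.4863515602294:ℝ) := (Real.log_le_log (by linarith) (by linarith)).trans lp1b_u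
  have L2l : (0.8121487297941:ℝ) ≤ Real.log (2*t+1) := lp2a_l.trans (Real.log_le_log (by norm_num) (by linarith))
  have L2u : Real.log (2*t+1) ≤ (0.8121487298048:ℝ) := (Real.log_le_log (by linarith) (by linarith)).trans lp2b_u
  have L3l : (1.0574829517500:ℝ) ≤ Real.log (3*t+1) := lp3a_l.trans (Real.log_le_log (by norm_num) (by linarith))
  have L3u : Real.log (3*t+1) ≤ (1.0574829517624:ℝ) := (Real.log_le_log (by linarith) (by linarith)).trans lp3b_u
  have L4l : (1.2882326066109:ℝ) ≤ Real.log (t+3) := lq3a_l.trans (Real.log_le_log (by norm_num) (by linarith))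
  have L4u : Real.log (t+3) ≤ (1.2882326066149:ℝ) := (Real.log_le_log (by linarith) (by linarith)).trans lq3b_u
  have L5l : (-0.4678113727159:ℝ) ≤ Real.log (t) := lta_l.trans (Real.log_le_log (by norm_num) (by linarith))
  have L5u : Real.log (t) ≤ (-0.4678113726974:ℝ) := (Real.log_le_log (by linarith) (by linarith)).trans ltb_u
  have L6 : Real.log 16 = 4 * Real.log 2 := by
    rw [show (16:ℝ) = 2^4 by norm_num, Real.log_pow]; norm_num
  have h2l := lg2_l
  have h2u := lg2_u
  have hm : 0 < 1 - t := by linarith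
  have h3 : 0 ≤ 3*t - 1 := by linarith
  unfold B0
  rw [L6]
  generalize Real.log (t+1) = L1 at *
  generalize Real.log (2*t+1) = L2 at *
  generalize Real.log (3*t+1) = L3 at *
  generalize Real.log (t+3) = L4 at *
  generalize Real.log (t) = L5 at *
  have p2l : (0.626371663301:ℝ)^2 ≤ t^2 := by gcongr
  have p2u : t^2 ≤ (0.626371663312:ℝ)^2 := by gcongr
  have p3l : (0.626371663301:ℝ)^3 ≤ t^3 := by gcongr
  have p3u : t^3 ≤ (0.626371663312:ℝ)^3 := by gcongr
  have p4l : (0.626371663301:ℝ)^4 ≤ t^4 := by gcongr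
  have p4u : t^4 ≤ (0.626371663312:ℝ)^4 := by gcongr
  have p5l : (0.626371663301:ℝ)^5 ≤ t^5 := by gcongr
  have p5u : t^5 ≤ (0.626371663312:ℝ)^5 := by gcongr
  have p6l : (0.626371663301:ℝ)^6 ≤ t^6 := by gcongr
  have p6u : t^6 ≤ (0.626371663312:ℝ)^6 := by gcongr
  have Ql : (2.1161809432725:ℝ) ≤ -(3*t^4-16*t^3+6*t^2-1) := by norm_num at *; linarith
  have Qu : -(3*t^4-16*t^3+6*t^2-1) ≤ (2.1161809435949:ℝ) := by norm_num at *; linarith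
  have Rl : (583.0255742581377:ℝ) ≤ 217*t^6+920*t^5+972*t^4+1436*t^3+205*t^2-172*t+6 := by norm_num at *; linarith
  have Ru : 217*t^6+920*t^5+972*t^4+1436*t^3+205*t^2-172*t+6 ≤ (583.0255743011272:ℝ) := by norm_num at *; linarith
  generalize 217*t^6+920*t^5+972*t^4+1436*t^3+205*t^2-172*t+6 = R at *
  have eq2 : (3*t^4-16*t^3+6*t^2-1)*L3/(32*t^3) = -((-(3*t^4-16*t^3+6*t^2-1))*L3/(32*t^3)) := by ring
  rw [eq2]
  generalize -(3*t^4-16*t^3+6*t^2-1) = Q at *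
  have L10 : 0 ≤ L1 := le_trans (by norm_num) L1l
  have L20 : 0 ≤ L2 := le_trans (by norm_num) L2l
  have L30 : 0 ≤ L3 := le_trans (by norm_num) L3l
  have Q0 : 0 ≤ Q := le_trans (by norm_num) Ql
  have R0 : 0 ≤ R := le_trans (by norm_num) Rl
  have T1l : (0.2249561665994:ℝ) ≤ (3*t-1)^2*(t+1)^6*L1/(512*t^6) := by
    calc (0.2249561665994:ℝ) ≤ (3*0.626371663301-1)^2*(0.626371663301+1)^6*0.4863515602217/(512*0.626371663312^6) := by norm_num
      _ ≤ (3*t-1)^2*(t+1)^6*L1/(512*t^6) := by gcongr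
  have T1u : (3*t-1)^2*(t+1)^6*L1/(512*t^6) ≤ (0.2249561666528:ℝ) := by
    calc (3*t-1)^2*(t+1)^6*L1/(512*t^6) ≤ (3*0.626371663312-1)^2*(0.626371663312+1)^6*0.4863515602294/(512*0.626371663301^6) := by gcongr
      _ ≤ (0.2249561666528:ℝ) := by norm_num
  have T2l : (0.2845639552553:ℝ) ≤ Q*L3/(32*t^3) := by
    calc (0.2845639552553:ℝ) ≤ 2.1161809432725*1.0574829517500/(32*0.626371663312^3) := by norm_num
      _ ≤ Q*L3/(32*t^3) := by gcongr
  have T2u : Q*L3/(32*t^3) ≤ (0.2845639553171:ℝ) := by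
    calc Q*L3/(32*t^3) ≤ 2.1161809435949*1.0574829517624/(32*0.626371663301^3) := by gcongr
      _ ≤ (0.2845639553171:ℝ) := by norm_num
  have T3l : (0.0002961419008:ℝ) ≤ (3*t+1)^2*(1-t)^6*L2/(1024*t^6) := by
    calc (0.0002961419008:ℝ) ≤ (3*0.626371663301+1)^2*(1-0.626371663312)^6*0.8121487297941/(1024*0.626371663312^6) := by norm_num
      _ ≤ (3*t+1)^2*(1-t)^6*L2/(1024*t^6) := by gcongr
  have T3u : (3*t+1)^2*(1-t)^6*L2/(1024*t^6) ≤ (0.0002961419010:ℝ) := by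
    calc (3*t+1)^2*(1-t)^6*L2/(1024*t^6) ≤ (3*0.626371663312+1)^2*(1-0.626371663301)^6*0.8121487298048/(1024*0.626371663301^6) := by gcongr
      _ ≤ (0.0002961419010:ℝ) := by norm_num
  have T4l : (0.0247273476041:ℝ) ≤ R*(1-t)^2/(2048*t^4*(3*t+1)*(t+3)) := by
    calc (0.0247273476041:ℝ) ≤ 583.0255742581377*(1-0.626371663312)^2/(2048*0.626371663312^4*(3*0.626371663312+1)*(0.626371663312+3)) := by norm_num
      _ ≤ R*(1-t)^2/(2048*t^4*(3*t+1)*(t+3)) := by gcongr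
  have T4u : R*(1-t)^2/(2048*t^4*(3*t+1)*(t+3)) ≤ (0.0247273476096:ℝ) := by
    calc R*(1-t)^2/(2048*t^4*(3*t+1)*(t+3)) ≤ 583.0255743011272*(1-0.626371663301)^2/(2048*0.626371663301^4*(3*0.626371663301+1)*(0.626371663301+3)) := by gcongr
      _ ≤ (0.0247273476096:ℝ) := by norm_num
  constructor <;> linarith
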